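/- arXiv:math/0508039 — 2 statements merged into one kernel-verified Lean document; each statement's English description precedes it below -/
import Mathlib

section
/- Let d ≥ 1, N ∈ ℕ, S a nonempty subset of {1,…,d}, and integers l_i with 1 ≤ l_i ≤ N for i ∈ S; if S = {1,…,d} assume additionally l_1+⋯+l_d > N. Let σ = (σ_1,…,σ_{d+1}) ∈ ℝ^{d+1} with σ_i = −l_i − 1 for i ∈ S and σ_i > −1 for i ∈ {1,…,d+1} \ S. Set V = {x ∈ ℕ_0^d : |x| ≤ N and x_i ≤ l_i for i ∈ S}. For ν ∈ V define Q_ν(x; σ, N) = [(−1)^{|ν|}/(−N)_{|ν|}] · Π_{j=1}^d [(σ_j+1)_{ν_j}/(a_j+1)_{ν_j}] · (−N + |X_{j−1}| + |ν^{j+1}|)_{ν_j} Q_{ν_j}(x_j; σ_j, a_j, N − |X_{j−1}| − |ν^{j+1}|), with a_j = |σ^{j+1}| + 2|ν^{j+1}| + d − j. Then for all ν, μ ∈ V, Σ_{x ∈ V} Q_ν(x;σ,N) Q_μ(x;σ,N) Π_{i=1}^d C(x_i+σ_i, x_i) · C(N−|x|+σ_{d+1}, N−|x|) = A_ν δ_{ν,μ},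 where A_ν = [(−1)^{|ν|} (|σ|+d+2|ν|+1)_{N−|ν|} / ((−N)_{|ν|} N!)] · Π_{j=1}^d [(σ_j+a_j+ν_j+1)_{ν_j} (σ_j+1)_{ν_j} ν_j! / (a_j+1)_{ν_j}]. -/
open Finset

/-- Pochhammer symbol `(a)_k = a(a+1)⋯(a+k−1)`. -/
noncomputable def poch (a : ℝ) (k : ℕ) : ℝ := ∏ i ∈ Finset.range k, (a + i)

/-- Generalized binomial coefficient `C(a, k) = (a−k+1)_k / k!`. -/
noncomputable def genBinom (a : ℝ) (k : ℕ) : ℝ :=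
  poch (a - k + 1) k / (Nat.factorial k : ℝ)

/-- Tail sum over 0-based indices `i ≥ t`. -/
noncomputable def tailFrom (d : ℕ) (y : Fin d → ℝ) (t : ℕ) : ℝ :=
  ∑ i, if t ≤ i.val then y i else 0

/-- Head sum over 0-based indices `i < j`. -/
noncomputable def headTo (d : ℕ) (y : Fin d → ℝ) (j : Fin d) : ℝ :=
  ∑ i, if i.val < j.val then y i else 0

/-- `(−M)_n Q_n(x; a, b, M)` where `Q_n` is the Hahn polynomial, interpreted
via the cancellation `(−M)_n/(−M)_k = (−M+k)_{n−k}`: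
`Σ_{k=0}^n (−n)_k (n+a+b+1)_k (−x)_k (−M+k)_{n−k} / ((a+1)_k k!)`. -/
noncomputable def hahnQM (n : ℕ) (x a b M : ℝ) : ℝ :=
  ∑ k ∈ Finset.range (n + 1),
    poch (-(n : ℝ)) k * poch ((n : ℝ) + a + b + 1) k * poch (-x) k
      * poch (-M + (k : ℝ)) (n - k)
      / (poch (a + 1) k * (Nat.factorial k : ℝ))

/-- `a_j = |σ^{j+1}| + 2|ν^{j+1}| + d − j` (0-based `j`). -/
noncomputable def aHahn (d : ℕ) (σ : Fin (d + 1) → ℝ) (ν : Fin d → ℕ)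
    (j : Fin d) : ℝ :=
  tailFrom (d + 1) σ (j.val + 1) + 2 * tailFrom d (fun i => (ν i : ℝ)) (j.val + 1)
    + ((d : ℝ) - j.val - 1)

/-- The Hahn polynomials `Q_ν(x; σ, N)` of several variables, (5.30). -/
noncomputable def hahnNu (d : ℕ) (σ : Fin (d + 1) → ℝ) (N : ℕ)
    (ν x : Fin d → ℕ) : ℝ :=
  (-1 : ℝ) ^ (∑ i, ν i) / poch (-(N : ℝ)) (∑ i, ν i)
    * ∏ j, (poch (σ j.castSucc + 1) (ν j) / poch (aHahn d σ ν j + 1) (ν j))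
      * hahnQM (ν j) (x j : ℝ) (σ j.castSucc) (aHahn d σ ν j)
          ((N : ℝ) - headTo d (fun i => (x i : ℝ)) j
            - tailFrom d (fun i => (ν i : ℝ)) (j.val + 1))

/-- The weight (5.29):
`W(x) = Π_i C(x_i+σ_i, x_i) · C(N−|x|+σ_{d+1}, N−|x|)`. -/
noncomputable def Whahn (d : ℕ) (σ : Fin (d + 1) → ℝ) (N : ℕ)
    (x : Fin d → ℕ) : ℝ :=
  (∏ i, genBinom ((x i : ℝ) + σ i.castSucc) (x i))
    * genBinom ((N : ℝ) - ((∑ i, x i : ℕ) : ℝ) + σ (Fin.last d)) (N - ∑ i, x i)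

/-- The norm `A_ν` of (5.32). -/
noncomputable def AnuHahn (d : ℕ) (σ : Fin (d + 1) → ℝ) (N : ℕ)
    (ν : Fin d → ℕ) : ℝ :=
  (-1 : ℝ) ^ (∑ i, ν i)
      * poch ((∑ i, σ i) + d + 2 * ((∑ i, ν i : ℕ) : ℝ) + 1) (N - ∑ i, ν i)
      / (poch (-(N : ℝ)) (∑ i, ν i) * (Nat.factorial N : ℝ))
    * ∏ j, poch (σ j.castSucc + aHahn d σ ν j + (ν j : ℝ) + 1) (ν j)
        * poch (σ j.castSucc + 1) (ν j) * (Nat.factorial (ν j) : ℝ)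
        / poch (aHahn d σ ν j + 1) (ν j)

section Poch

lemma poch_zero (a : ℝ) : poch a 0 = 1 := by simp [poch]

lemma poch_succ (a : ℝ) (k : ℕ) : poch a (k + 1) = poch a k * (a + k) := by
  simp [poch, Finset.prod_range_succ]

lemma poch_add (a : ℝ) (m n : ℕ) : poch a (m + n) = poch a m * poch (a + m) n := by
  simp [poch, Finset.prod_range_add, add_assoc]

/-- The Chu–Vandermonde identity for Pochhammer symbols. -/
lemma poch_vandermonde (a b : ℝ) (n : ℕ) :
    poch (a + b) n =
      ∑ k ∈ range (n + 1), (n.choose k : ℝ) * poch a k * poch b (n - k) := by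
  induction n with
  | zero => simp [poch_zero]
  | succ n ih =>
    rw [poch_succ, ih, Finset.sum_mul]
    have hsplit : ∀ k ∈ range (n + 1),
        (n.choose k : ℝ) * poch a k * poch b (n - k) * (a + b + n) =
          (n.choose k : ℝ) * poch a (k + 1) * poch b (n - k)
            + (n.choose k : ℝ) * poch a k * poch b (n + 1 - k) := by
      intro k hk
      have hk' : k ≤ n := Nat.lt_succ_iff.mp (Finset.mem_range.mp hk)
      rw [Nat.succ_sub hk', poch_succ, poch_succ, Nat.cast_sub hk']
      ring
    have hreindex : ∑ k ∈ range (n + 1), (n.choose k : ℝ) * poch a k * poch b (n + 1 - k) =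
        ∑ k ∈ range (n + 1),
          (n.choose (k + 1) : ℝ) * poch a (k + 1) * poch b (n + 1 - (k + 1))
          + poch b (n + 1) := by
      have h1 := Finset.sum_range_succ
        (fun k => (n.choose k : ℝ) * poch a k * poch b (n + 1 - k)) (n + 1)
      rw [Finset.sum_range_succ'] at h1
      simpa [poch_zero] using h1.symm
    have hpascal : ∀ k ∈ range (n + 1),
        ((n + 1).choose (k + 1) : ℝ) * poch a (k + 1) * poch b (n + 1 - (k + 1)) =
          (n.choose k : ℝ) * poch a (k + 1) * poch b (n - k)
            + (n.choose (k + 1) : ℝ) * poch a (k + 1) * poch b (n + 1 - (k + 1)) := by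
      intro k _
      rw [Nat.choose_succ_succ, Nat.succ_sub_succ]
      push_cast
      ring
    rw [Finset.sum_congr rfl hsplit, Finset.sum_add_distrib, hreindex,
      Finset.sum_range_succ' _ (n + 1), Finset.sum_congr rfl hpascal, Finset.sum_add_distrib]
    simp [poch_zero, add_assoc]

/-- Chu–Vandermonde as a convolution of normalised Pochhammer symbols. -/
lemma poch_div_factorial_convolution (a b : ℝ) (n : ℕ) :
    ∑ k ∈ range (n + 1),
        poch a k / (k.factorial : ℝ) * (poch b (n - k) / ((n - k).factorial : ℝ)) =
      poch (a + b) n / (n.factorial : ℝ) := by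
  rw [poch_vandermonde, Finset.sum_div]
  refine Finset.sum_congr rfl fun k hk => ?_
  rw [Nat.cast_choose ℝ (Nat.lt_succ_iff.mp (Finset.mem_range.mp hk))]
  have h1 : (n.factorial : ℝ) ≠ 0 := by positivity
  have h2 : (k.factorial : ℝ) ≠ 0 := by positivity
  have h3 : ((n - k).factorial : ℝ) ≠ 0 := by positivity
  field_simp

lemma poch_neg_eq (a : ℝ) (n : ℕ) : poch (-a) n = (-1) ^ n * poch (a - n + 1) n := by
  have hpow : (-1 : ℝ) ^ n = ∏ _i ∈ range n, (-1) := by simp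
  rw [poch, poch, ← Finset.prod_range_reflect, hpow, ← Finset.prod_mul_distrib]
  refine Finset.prod_congr rfl fun i hi => ?_
  have hi' := Finset.mem_range.mp hi
  rw [show n - 1 - i = n - (i + 1) by omega, Nat.cast_sub hi']
  push_cast
  ring

lemma poch_neg_natCast_of_lt {n k : ℕ} (h : n < k) : poch (-(n : ℝ)) k = 0 :=
  Finset.prod_eq_zero (Finset.mem_range.mpr h) (by simp)

/-- `(-n)_k (n-k)! = (-1)^k n!` for `k ≤ n`. -/
lemma poch_neg_natCast_mul_factorial {n k : ℕ} (h : k ≤ n) :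
    poch (-(n : ℝ)) k * ((n - k).factorial : ℝ) = (-1) ^ k * (n.factorial : ℝ) := by
  induction k with
  | zero => simp [poch_zero]
  | succ k ih =>
    have e : n - k = n - (k + 1) + 1 := by omega
    have := ih (by omega)
    rw [e, Nat.factorial_succ, ← e, Nat.cast_mul, Nat.cast_sub (by omega : k ≤ n)] at this
    rw [poch_succ, pow_succ]
    linear_combination -this

lemma poch_neg_natCast_ne_zero {n k : ℕ} (h : k ≤ n) : poch (-(n : ℝ)) k ≠ 0 := by
  intro h0
  have h1 := poch_neg_natCast_mul_factorial h
  rw [h0, zero_mul] at h1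
  exact mul_ne_zero (pow_ne_zero _ (by norm_num)) (by positivity) h1.symm

lemma poch_ne_zero_of_le {a : ℝ} {k n : ℕ} (h : poch a n ≠ 0) (hk : k ≤ n) :
    poch a k ≠ 0 := by
  obtain ⟨m, rfl⟩ := Nat.exists_eq_add_of_le hk
  rw [poch_add] at h
  exact left_ne_zero_of_mul h

end Poch

section Hahn

/-- The moment of `(-x)_k` against a product of two normalised Pochhammer symbols. -/
lemma sum_poch_neg_mul_weight (a c : ℝ) {k M : ℕ} (hk : k ≤ M) :
    ∑ x ∈ range (M + 1), poch (-(x : ℝ)) k * (poch a x / (x.factorial : ℝ))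
        * (poch c (M - x) / ((M - x).factorial : ℝ)) =
      (-1) ^ k * poch a k * (poch (a + k + c) (M - k) / ((M - k).factorial : ℝ)) := by
  obtain ⟨m, rfl⟩ := Nat.exists_eq_add_of_le hk
  rw [add_assoc, Finset.sum_range_add, Finset.sum_eq_zero, zero_add, Nat.add_sub_cancel_left,
    ← poch_div_factorial_convolution, Finset.mul_sum]
  · refine Finset.sum_congr rfl fun x _ => ?_
    have h := poch_neg_natCast_mul_factorial (Nat.le_add_right k x)
    rw [Nat.add_sub_cancel_left] at h
    rw [Nat.add_sub_add_left, poch_add a k x]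
    have h1 : ((k + x).factorial : ℝ) ≠ 0 := by positivity
    have h2 : (x.factorial : ℝ) ≠ 0 := by positivity
    have h3 : ((m - x).factorial : ℝ) ≠ 0 := by positivity
    field_simp
    linear_combination poch a k * poch (a + k) x * poch c (m - x) * h
  · intro x hx
    rw [poch_neg_natCast_of_lt (Finset.mem_range.mp hx)]
    simp

lemma hahnQM_eq_zero_of_lt {n x M : ℕ} (a b : ℝ) (hM : M < n) (hx : x ≤ M) :
    hahnQM n x a b M = 0 := by
  refine Finset.sum_eq_zero fun k hk => ?_
  rcases Nat.lt_or_ge x k with h | h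
  · simp [poch_neg_natCast_of_lt h]
  · have : poch (-(M : ℝ) + k) (n - k) = 0 := by
      rw [show -(M : ℝ) + k = -((M - k : ℕ) : ℝ) by
        rw [Nat.cast_sub (h.trans hx)]; ring]
      exact poch_neg_natCast_of_lt (by omega)
    simp [this]

/-- The one-variable Hahn weight `C(x+a, x) C(M-x+b, M-x)`. -/
noncomputable def hahnWeight (a b : ℝ) (M x : ℕ) : ℝ :=
  poch (a + 1) x / (x.factorial : ℝ) * (poch (b + 1) (M - x) / ((M - x).factorial : ℝ))

/-- Pairing of a Hahn polynomial with the shifted factorial `(b+1+M-x)_m`. -/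
lemma sum_hahnQM_mul_poch (a b : ℝ) {n M : ℕ} (m : ℕ) (hn : n ≤ M)
    (ha : poch (a + 1) n ≠ 0) :
    ∑ x ∈ range (M + 1),
        hahnQM n x a b M * poch (b + 1 + ((M : ℝ) - x)) m * hahnWeight a b M x =
      poch (b + 1) m * poch (-(m : ℝ)) n * poch (a + b + m + n + 2) (M - n)
        / ((M - n).factorial : ℝ) := by
  have hshift : ∀ x ∈ range (M + 1),
      hahnQM n x a b M * poch (b + 1 + ((M : ℝ) - x)) m * hahnWeight a b M x =
        ∑ k ∈ range (n + 1),
          poch (-(n : ℝ)) k * poch ((n : ℝ) + a + b + 1) k * poch (-(M : ℝ) + k) (n - k)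
            / (poch (a + 1) k * (k.factorial : ℝ)) * poch (b + 1) m
            * (poch (-(x : ℝ)) k * (poch (a + 1) x / (x.factorial : ℝ))
              * (poch (b + 1 + m) (M - x) / ((M - x).factorial : ℝ))) := by
    intro x hx
    have h : poch (b + 1) (M - x) * poch (b + 1 + ((M : ℝ) - x)) m =
        poch (b + 1) m * poch (b + 1 + m) (M - x) := by
      rw [← Nat.cast_sub (Nat.lt_succ_iff.mp (Finset.mem_range.mp hx)), ← poch_add,
        Nat.add_comm, poch_add]
    rw [hahnQM, hahnWeight, Finset.sum_mul, Finset.sum_mul]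
    refine Finset.sum_congr rfl fun k _ => ?_
    linear_combination poch (-(n : ℝ)) k * poch ((n : ℝ) + a + b + 1) k * poch (-(x : ℝ)) k
      * poch (-(M : ℝ) + k) (n - k) / (poch (a + 1) k * (k.factorial : ℝ))
      * (poch (a + 1) x / (x.factorial : ℝ)) / ((M - x).factorial : ℝ) * h
  rw [Finset.sum_congr rfl hshift, Finset.sum_comm]
  have hterm : ∀ k ∈ range (n + 1), ∑ x ∈ range (M + 1),
      poch (-(n : ℝ)) k * poch ((n : ℝ) + a + b + 1) k * poch (-(M : ℝ) + k) (n - k)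
            / (poch (a + 1) k * (k.factorial : ℝ)) * poch (b + 1) m
            * (poch (-(x : ℝ)) k * (poch (a + 1) x / (x.factorial : ℝ))
              * (poch (b + 1 + m) (M - x) / ((M - x).factorial : ℝ))) =
      poch (b + 1) m * poch (a + b + m + n + 2) (M - n) / ((M - n).factorial : ℝ)
        * ((n.choose k : ℝ) * poch ((n : ℝ) + a + b + 1) k
          * poch (-(a + b + m + n + 1)) (n - k)) := by
    intro k hk
    have hkn : k ≤ n := Nat.lt_succ_iff.mp (Finset.mem_range.mp hk)
    have hak := poch_ne_zero_of_le ha hkn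
    rw [← Finset.mul_sum, sum_poch_neg_mul_weight _ _ (hkn.trans hn)]
    have e1 := poch_neg_natCast_mul_factorial hkn
    have e2 : poch (-(M : ℝ) + k) (n - k) * ((M - n).factorial : ℝ) =
        (-1) ^ (n - k) * ((M - k).factorial : ℝ) := by
      have := poch_neg_natCast_mul_factorial (n := M - k) (k := n - k) (by omega)
      rw [Nat.cast_sub (hkn.trans hn), show M - k - (n - k) = M - n by omega] at this
      rw [← this]
      congr 2
      ring
    have e3 : poch (a + 1 + k + (b + 1 + m)) (M - k) =
        (-1) ^ (n - k) * poch (-(a + b + m + n + 1)) (n - k)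
          * poch (a + b + m + n + 2) (M - n) := by
      rw [show M - k = (n - k) + (M - n) by omega, poch_add, poch_neg_eq,
        ← mul_assoc, ← mul_pow, Nat.cast_sub hkn]
      norm_num
      congr 2 <;> ring
    have e4 : (-1 : ℝ) ^ (n - k) * (-1) ^ (n - k) = 1 := by rw [← mul_pow]; norm_num
    have e5 : (-1 : ℝ) ^ k * (-1) ^ k = 1 := by rw [← mul_pow]; norm_num
    rw [e3, Nat.cast_choose ℝ hkn]
    have h2 : (k.factorial : ℝ) ≠ 0 := by positivity
    have h3 : ((n - k).factorial : ℝ) ≠ 0 := by positivity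
    have h4 : ((M - n).factorial : ℝ) ≠ 0 := by positivity
    have h5 : ((M - k).factorial : ℝ) ≠ 0 := by positivity
    rw [eq_div_of_mul_eq h3 e1, eq_div_of_mul_eq h4 e2]
    field_simp
    linear_combination poch ((n : ℝ) + a + b + 1) k * poch (b + 1) m
      * poch (-(a + b + m + n + 1)) (n - k) * poch (a + b + m + n + 2) (M - n)
      * (((-1 : ℝ) ^ k * (-1) ^ k) * e4 + e5)
  rw [Finset.sum_congr rfl hterm, ← Finset.mul_sum, ← poch_vandermonde]
  rw [show (n : ℝ) + a + b + 1 + -(a + b + m + n + 1) = -m by ring]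
  ring

/-- Pairing of `(-M)_n Q_n` with `(-M)_m Q_m` for `m ≤ n ≤ M`. -/
lemma sum_hahnQM_mul_hahnQM (a b : ℝ) {m n M : ℕ} (hmn : m ≤ n) (hn : n ≤ M)
    (ha : poch (a + 1) n ≠ 0) :
    ∑ x ∈ range (M + 1), hahnQM n x a b M * hahnQM m x a b M * hahnWeight a b M x =
      if n = m then poch (b + 1) n * poch (n + a + b + 1) n * (n.factorial : ℝ)
        * poch (a + b + 2 * n + 2) (M - n) / (poch (a + 1) n * ((M - n).factorial : ℝ))
      else 0 := by
  have hexp : ∀ x ∈ range (M + 1),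
      hahnQM n x a b M * hahnQM m x a b M * hahnWeight a b M x =
        ∑ k ∈ range (m + 1), ∑ j ∈ range (k + 1),
          poch (-(m : ℝ)) k * poch ((m : ℝ) + a + b + 1) k * poch (-(M : ℝ) + k) (m - k)
            / (poch (a + 1) k * (k.factorial : ℝ))
            * ((k.choose j : ℝ) * poch (-(b + 1 + M)) (k - j))
            * (hahnQM n x a b M * poch (b + 1 + ((M : ℝ) - x)) j * hahnWeight a b M x) := by
    intro x _
    conv_lhs => rw [hahnQM.eq_1 m, Finset.mul_sum, Finset.sum_mul]
    refine Finset.sum_congr rfl fun k _ => ?_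
    rw [show -(x : ℝ) = (b + 1 + ((M : ℝ) - x)) + -(b + 1 + M) by ring,
      poch_vandermonde (b + 1 + ((M : ℝ) - x))]
    simp only [Finset.mul_sum, Finset.sum_mul, Finset.sum_div]
    refine Finset.sum_congr rfl fun j _ => ?_
    ring
  rw [Finset.sum_congr rfl hexp, Finset.sum_comm]
  have hterm : ∀ k ∈ range (m + 1), ∑ x ∈ range (M + 1), ∑ j ∈ range (k + 1),
          poch (-(m : ℝ)) k * poch ((m : ℝ) + a + b + 1) k * poch (-(M : ℝ) + k) (m - k)
            / (poch (a + 1) k * (k.factorial : ℝ))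
            * ((k.choose j : ℝ) * poch (-(b + 1 + M)) (k - j))
            * (hahnQM n x a b M * poch (b + 1 + ((M : ℝ) - x)) j * hahnWeight a b M x) =
      ∑ j ∈ range (k + 1),
          poch (-(m : ℝ)) k * poch ((m : ℝ) + a + b + 1) k * poch (-(M : ℝ) + k) (m - k)
            / (poch (a + 1) k * (k.factorial : ℝ))
            * ((k.choose j : ℝ) * poch (-(b + 1 + M)) (k - j))
            * (poch (b + 1) j * poch (-(j : ℝ)) n * poch (a + b + j + n + 2) (M - n)
        / ((M - n).factorial : ℝ)) := by
    intro k _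
    rw [Finset.sum_comm]
    refine Finset.sum_congr rfl fun j _ => ?_
    rw [← Finset.mul_sum, sum_hahnQM_mul_poch a b j hn ha]
  rw [Finset.sum_congr rfl hterm]
  split_ifs with h
  · subst h
    rw [Finset.sum_range_succ, Finset.sum_eq_zero, Finset.sum_range_succ, Finset.sum_eq_zero]
    · have e := poch_neg_natCast_mul_factorial (le_refl n)
      have e5 : (-1 : ℝ) ^ n * (-1) ^ n = 1 := by rw [← mul_pow]; norm_num
      have h2 : (n.factorial : ℝ) ≠ 0 := by positivity
      have h4 : ((M - n).factorial : ℝ) ≠ 0 := by positivity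
      simp only [Nat.sub_self, Nat.factorial_zero, Nat.cast_one, mul_one] at e
      simp only [Nat.sub_self, poch_zero, Nat.choose_self, Nat.cast_one, e, mul_one, zero_add]
      rw [show a + b + n + n + 2 = a + b + 2 * n + 2 by ring]
      field_simp
      linear_combination poch ((n : ℝ) + a + b + 1) n * poch (b + 1) n
        * poch (a + b + n * 2 + 2) (M - n) * e5
    · intro j hj
      rw [poch_neg_natCast_of_lt (Finset.mem_range.mp hj)]
      simp
    · intro k hk
      refine Finset.sum_eq_zero fun j hj => ?_
      rw [Finset.mem_range] at hk hj
      rw [poch_neg_natCast_of_lt (show j < n by omega)]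
      simp
  · refine Finset.sum_eq_zero fun k hk => Finset.sum_eq_zero fun j hj => ?_
    rw [Finset.mem_range] at hk hj
    rw [poch_neg_natCast_of_lt (show j < n by omega)]
    simp

/-- Orthogonality of one-variable Hahn polynomials, for arbitrary real parameters. -/
lemma hahn_orthogonality (a b : ℝ) (m n M : ℕ) :
    ∑ x ∈ range (M + 1),
        (poch (a + 1) n / poch (b + 1) n * hahnQM n x a b M)
          * (poch (a + 1) m / poch (b + 1) m * hahnQM m x a b M) * hahnWeight a b M x =
      if n = m ∧ n ≤ M then poch (a + b + n + 1) n * poch (a + 1) n * (n.factorial : ℝ)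
        / poch (b + 1) n
        * (poch (a + b + 2 * n + 2) (M - n) / ((M - n).factorial : ℝ))
      else 0 := by
  wlog hmn : m ≤ n generalizing m n with H
  · have := H n m (by omega)
    rw [if_neg (by omega)] at this ⊢
    rw [← this]
    exact Finset.sum_congr rfl fun x _ => by ring
  rcases Nat.lt_or_ge M n with hM | hM
  · rw [if_neg (by omega)]
    refine Finset.sum_eq_zero fun x hx => ?_
    rw [hahnQM_eq_zero_of_lt a b hM (Nat.lt_succ_iff.mp (Finset.mem_range.mp hx))]
    simp
  by_cases ha : poch (a + 1) n = 0
  · simp [ha]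
  have hfac : ∀ x ∈ range (M + 1),
      (poch (a + 1) n / poch (b + 1) n * hahnQM n x a b M)
          * (poch (a + 1) m / poch (b + 1) m * hahnQM m x a b M) * hahnWeight a b M x =
        poch (a + 1) n / poch (b + 1) n * (poch (a + 1) m / poch (b + 1) m)
          * (hahnQM n x a b M * hahnQM m x a b M * hahnWeight a b M x) := fun x _ => by ring
  rw [Finset.sum_congr rfl hfac, ← Finset.mul_sum, sum_hahnQM_mul_hahnQM a b hmn hM ha]
  by_cases h : n = m
  · subst h
    rw [if_pos rfl, if_pos ⟨rfl, hM⟩, show (n : ℝ) + a + b + 1 = a + b + n + 1 by ring]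
    by_cases hb : poch (b + 1) n = 0
    · simp [hb]
    have h4 : ((M - n).factorial : ℝ) ≠ 0 := by positivity
    field_simp
  · rw [if_neg h, if_neg (fun h' => h h'.1), mul_zero]

end Hahn

section SeveralVariables

/-- The lattice simplex `{x ∈ ℕ₀^d : |x| ≤ N}`. -/
def latticeSimplex (d N : ℕ) : Finset (Fin d → ℕ) :=
  Finset.filter (fun x => ∑ i, x i ≤ N) (Finset.Iic fun _ => N)

lemma mem_latticeSimplex {d N : ℕ} {x : Fin d → ℕ} :
    x ∈ latticeSimplex d N ↔ ∑ i, x i ≤ N := by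
  rw [latticeSimplex, Finset.mem_filter, Finset.mem_Iic, and_iff_right_iff_imp]
  intro h i
  exact (Finset.single_le_sum (fun _ _ => Nat.zero_le _) (Finset.mem_univ i)).trans h

lemma sum_latticeSimplex_succ (d N : ℕ) (f : (Fin (d + 1) → ℕ) → ℝ) :
    ∑ x ∈ latticeSimplex (d + 1) N, f x =
      ∑ x ∈ latticeSimplex d N, ∑ t ∈ range (N - ∑ i, x i + 1),
        f (Fin.snoc (α := fun _ => ℕ) x t) := by
  rw [Finset.sum_sigma']
  refine Finset.sum_bij' (fun x _ => ⟨Fin.init x, x (Fin.last d)⟩)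
    (fun p _ => Fin.snoc (α := fun _ => ℕ) p.1 p.2) ?_ ?_ ?_ ?_ ?_
  · intro x hx
    rw [mem_latticeSimplex, Fin.sum_univ_castSucc] at hx
    simp only [Finset.mem_sigma, mem_latticeSimplex, Finset.mem_range, Fin.init]
    omega
  · rintro ⟨x, t⟩ hx
    simp only [Finset.mem_sigma, mem_latticeSimplex, Finset.mem_range] at hx
    rw [mem_latticeSimplex, Fin.sum_univ_castSucc]
    simp only [Fin.snoc_castSucc, Fin.snoc_last]
    omega
  · intro x _
    exact Fin.snoc_init_self x
  · rintro ⟨x, t⟩ _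
    simp
  · intro x _
    rw [Fin.snoc_init_self]

lemma genBinom_add_self (a : ℝ) (k : ℕ) :
    genBinom ((k : ℝ) + a) k = poch (a + 1) k / (k.factorial : ℝ) := by
  rw [genBinom, show (k : ℝ) + a - k + 1 = a + 1 by ring]

/-- Parameters left after summing out the last variable, of degree `n`. -/
noncomputable def contractParam {d : ℕ} (σ : Fin (d + 2) → ℝ) (n : ℕ) : Fin (d + 1) → ℝ :=
  Fin.snoc (α := fun _ => ℝ) (fun i : Fin d => σ i.castSucc.castSucc)
    (σ (Fin.last d).castSucc + σ (Fin.last (d + 1)) + 1 + 2 * n)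

lemma contractParam_castSucc {d : ℕ} (σ : Fin (d + 2) → ℝ) (n : ℕ) (i : Fin d) :
    contractParam σ n i.castSucc = σ i.castSucc.castSucc := by
  simp [contractParam]

lemma contractParam_last {d : ℕ} (σ : Fin (d + 2) → ℝ) (n : ℕ) :
    contractParam σ n (Fin.last d) =
      σ (Fin.last d).castSucc + σ (Fin.last (d + 1)) + 1 + 2 * n := by
  simp [contractParam]

lemma aHahn_snoc_castSucc {d : ℕ} (σ : Fin (d + 2) → ℝ) (ν : Fin d → ℕ) (n : ℕ) (j : Fin d) :
    aHahn (d + 1) σ (Fin.snoc (α := fun _ => ℕ) ν n) j.castSucc =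
      aHahn d (contractParam σ n) ν j := by
  have hj := j.isLt
  simp only [aHahn, tailFrom, Fin.sum_univ_castSucc, contractParam_castSucc, contractParam_last,
    Fin.val_castSucc, Fin.val_last, Fin.snoc_castSucc, Fin.snoc_last]
  rw [if_pos (by omega), if_pos (by omega), if_pos (by omega), if_pos (by omega)]
  push_cast
  ring

lemma aHahn_snoc_last {d : ℕ} (σ : Fin (d + 2) → ℝ) (ν : Fin d → ℕ) (n : ℕ) :
    aHahn (d + 1) σ (Fin.snoc (α := fun _ => ℕ) ν n) (Fin.last d) = σ (Fin.last (d + 1)) := by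
  have h : ∀ i : Fin d, ¬ (d < i.val) := fun i => by have := i.isLt; omega
  simp [aHahn, tailFrom, Fin.sum_univ_castSucc, h]

lemma tailFrom_snoc_castSucc {d : ℕ} (ν : Fin d → ℕ) (n : ℕ) (j : Fin d) :
    tailFrom (d + 1) (fun i => ((Fin.snoc (α := fun _ => ℕ) ν n i : ℕ) : ℝ)) (j.val + 1) =
      tailFrom d (fun i => (ν i : ℝ)) (j.val + 1) + n := by
  have hj := j.isLt
  simp only [tailFrom, Fin.sum_univ_castSucc, Fin.val_castSucc, Fin.val_last, Fin.snoc_castSucc,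
    Fin.snoc_last]
  rw [if_pos (by omega)]

lemma tailFrom_top {d : ℕ} (y : Fin d → ℝ) : tailFrom d y d = 0 :=
  Finset.sum_eq_zero fun i _ => if_neg (by have := i.isLt; omega)

lemma headTo_snoc_castSucc {d : ℕ} (x : Fin d → ℕ) (t : ℕ) (j : Fin d) :
    headTo (d + 1) (fun i => ((Fin.snoc (α := fun _ => ℕ) x t i : ℕ) : ℝ)) j.castSucc =
      headTo d (fun i => (x i : ℝ)) j := by
  have hj := j.isLt
  simp only [headTo, Fin.sum_univ_castSucc, Fin.val_castSucc, Fin.val_last, Fin.snoc_castSucc,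
    Fin.snoc_last]
  rw [if_neg (by omega), add_zero]

lemma headTo_snoc_last {d : ℕ} (x : Fin d → ℕ) (t : ℕ) :
    headTo (d + 1) (fun i => ((Fin.snoc (α := fun _ => ℕ) x t i : ℕ) : ℝ)) (Fin.last d) =
      ((∑ i, x i : ℕ) : ℝ) := by
  simp [headTo, Fin.sum_univ_castSucc]

lemma sum_snoc {d : ℕ} (x : Fin d → ℕ) (t : ℕ) :
    ∑ i, Fin.snoc (α := fun _ => ℕ) x t i = ∑ i, x i + t := by
  simp [Fin.sum_univ_castSucc]

lemma poch_neg_natCast_add {N n : ℕ} (k : ℕ) (hn : n ≤ N) :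
    poch (-(N : ℝ)) (k + n) = poch (-(N : ℝ)) n * poch (-((N - n : ℕ) : ℝ)) k := by
  rw [add_comm, poch_add, Nat.cast_sub hn]
  congr 2
  ring

/-- Splitting off the last variable of a Hahn polynomial of several variables. -/
lemma hahnNu_snoc {d N : ℕ} (σ : Fin (d + 2) → ℝ) (ν x : Fin d → ℕ) (n t : ℕ)
    (hn : n ≤ N) (hx : ∑ i, x i ≤ N) :
    hahnNu (d + 1) σ N (Fin.snoc (α := fun _ => ℕ) ν n) (Fin.snoc (α := fun _ => ℕ) x t) =
      (-1) ^ n / poch (-(N : ℝ)) n * hahnNu d (contractParam σ n) (N - n) ν x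
        * (poch (σ (Fin.last d).castSucc + 1) n / poch (σ (Fin.last (d + 1)) + 1) n
          * hahnQM n t (σ (Fin.last d).castSucc) (σ (Fin.last (d + 1)))
            ((N - ∑ i, x i : ℕ) : ℝ)) := by
  have hM : ∀ j : Fin d, (N : ℝ) - headTo d (fun i => (x i : ℝ)) j
      - (tailFrom d (fun i => (ν i : ℝ)) (j.val + 1) + n) =
      ((N - n : ℕ) : ℝ) - headTo d (fun i => (x i : ℝ)) j
        - tailFrom d (fun i => (ν i : ℝ)) (j.val + 1) := by
    intro j
    rw [Nat.cast_sub hn]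
    ring
  rw [hahnNu, hahnNu, Fin.prod_univ_castSucc, sum_snoc]
  simp only [Fin.val_castSucc, Fin.val_last, aHahn_snoc_castSucc, aHahn_snoc_last,
    Fin.snoc_castSucc, Fin.snoc_last, tailFrom_snoc_castSucc, headTo_snoc_castSucc,
    headTo_snoc_last, tailFrom_top, hM, contractParam_castSucc, sub_zero, ← Nat.cast_sub hx]
  rw [poch_neg_natCast_add _ hn, pow_add]
  ring

lemma Whahn_snoc {d N : ℕ} (σ : Fin (d + 2) → ℝ) (x : Fin d → ℕ) {t : ℕ}
    (hx : ∑ i, x i + t ≤ N) :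
    Whahn (d + 1) σ N (Fin.snoc (α := fun _ => ℕ) x t) =
      (∏ i, genBinom ((x i : ℝ) + σ i.castSucc.castSucc) (x i))
        * hahnWeight (σ (Fin.last d).castSucc) (σ (Fin.last (d + 1))) (N - ∑ i, x i) t := by
  rw [Whahn, Fin.prod_univ_castSucc, sum_snoc, ← Nat.cast_sub hx, genBinom_add_self]
  simp only [Fin.snoc_castSucc, Fin.snoc_last]
  rw [genBinom_add_self, hahnWeight, Nat.sub_add_eq, mul_assoc]

lemma Whahn_eq {d N : ℕ} (σ : Fin (d + 1) → ℝ) (x : Fin d → ℕ) (hx : ∑ i, x i ≤ N) :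
    Whahn d σ N x = (∏ i, genBinom ((x i : ℝ) + σ i.castSucc) (x i))
      * (poch (σ (Fin.last d) + 1) (N - ∑ i, x i) / ((N - ∑ i, x i).factorial : ℝ)) := by
  rw [Whahn, ← Nat.cast_sub hx, genBinom_add_self]

/-- Splitting off the last index of the norm. -/
lemma AnuHahn_snoc {d N : ℕ} (σ : Fin (d + 2) → ℝ) (ν : Fin d → ℕ) (n : ℕ) (hn : n ≤ N) :
    AnuHahn (d + 1) σ N (Fin.snoc (α := fun _ => ℕ) ν n) =
      ((-1) ^ n / poch (-(N : ℝ)) n) ^ 2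
        * (poch (σ (Fin.last d).castSucc + σ (Fin.last (d + 1)) + n + 1) n
          * poch (σ (Fin.last d).castSucc + 1) n * (n.factorial : ℝ)
          / poch (σ (Fin.last (d + 1)) + 1) n)
        * AnuHahn d (contractParam σ n) (N - n) ν := by
  have hfac : ((-1) ^ n / poch (-(N : ℝ)) n) ^ 2 / ((N - n).factorial : ℝ) =
      (-1) ^ n / (poch (-(N : ℝ)) n * (N.factorial : ℝ)) := by
    have h := poch_neg_natCast_mul_factorial hn
    have h0 := poch_neg_natCast_ne_zero hn
    have h1 : (N.factorial : ℝ) ≠ 0 := by positivity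
    have h2 : ((N - n).factorial : ℝ) ≠ 0 := by positivity
    field_simp
    linear_combination -h
  have harg : (∑ i, σ i) + ((d + 1 : ℕ) : ℝ) + 2 * ((∑ i, ν i + n : ℕ) : ℝ) + 1 =
      (∑ i, contractParam σ n i) + d + 2 * ((∑ i, ν i : ℕ) : ℝ) + 1 := by
    simp only [Fin.sum_univ_castSucc, contractParam_castSucc, contractParam_last]
    push_cast
    ring
  rw [AnuHahn, AnuHahn, Fin.prod_univ_castSucc, sum_snoc, harg]
  simp only [aHahn_snoc_castSucc, aHahn_snoc_last,
    Fin.snoc_castSucc, Fin.snoc_last, contractParam_castSucc]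
  rw [poch_neg_natCast_add _ hn, pow_add, Nat.sub_add_eq, Nat.sub_right_comm]
  linear_combination -hfac * (-1) ^ (∑ i, ν i)
    * poch ((∑ i, contractParam σ n i) + d + 2 * ((∑ i, ν i : ℕ) : ℝ) + 1) (N - n - ∑ i, ν i)
    / poch (-((N - n : ℕ) : ℝ)) (∑ i, ν i)
    * (∏ j, poch (σ j.castSucc.castSucc + aHahn d (contractParam σ n) ν j + (ν j : ℝ) + 1) (ν j)
        * poch (σ j.castSucc.castSucc + 1) (ν j) * (Nat.factorial (ν j) : ℝ)
        / poch (aHahn d (contractParam σ n) ν j + 1) (ν j))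
    * (poch (σ (Fin.last d).castSucc + σ (Fin.last (d + 1)) + n + 1) n
          * poch (σ (Fin.last d).castSucc + 1) n * (n.factorial : ℝ)
          / poch (σ (Fin.last (d + 1)) + 1) n)

/-- Orthogonality on the full lattice simplex, for arbitrary real parameters. -/
lemma hahnNu_orthogonality_simplex (d N : ℕ) (σ : Fin (d + 1) → ℝ) (ν μ : Fin d → ℕ)
    (hν : ∑ i, ν i ≤ N) (hμ : ∑ i, μ i ≤ N) :
    ∑ x ∈ latticeSimplex d N, hahnNu d σ N ν x * hahnNu d σ N μ x * Whahn d σ N x =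
      if ν = μ then AnuHahn d σ N ν else 0 := by
  induction d generalizing N with
  | zero =>
    have huniv : latticeSimplex 0 N = {ν} := by
      ext x
      simp [mem_latticeSimplex, Subsingleton.elim x ν]
    rw [huniv, Finset.sum_singleton, if_pos (Subsingleton.elim _ _), Whahn_eq _ _ hν]
    simp [hahnNu, AnuHahn, poch_zero]
  | succ d ih =>
    obtain ⟨ν, n, rfl⟩ : ∃ (ν' : Fin d → ℕ) (n : ℕ), ν = Fin.snoc (α := fun _ => ℕ) ν' n :=
      ⟨_, _, (Fin.snoc_init_self ν).symm⟩
    obtain ⟨μ, m, rfl⟩ : ∃ (μ' : Fin d → ℕ) (m : ℕ), μ = Fin.snoc (α := fun _ => ℕ) μ' m :=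
      ⟨_, _, (Fin.snoc_init_self μ).symm⟩
    rw [sum_snoc] at hν hμ
    have hn : n ≤ N := by omega
    have hm : m ≤ N := by omega
    have hinner : ∀ x ∈ latticeSimplex d N, ∑ t ∈ range (N - ∑ i, x i + 1),
        hahnNu (d + 1) σ N (Fin.snoc (α := fun _ => ℕ) ν n) (Fin.snoc (α := fun _ => ℕ) x t)
          * hahnNu (d + 1) σ N (Fin.snoc (α := fun _ => ℕ) μ m) (Fin.snoc (α := fun _ => ℕ) x t)
          * Whahn (d + 1) σ N (Fin.snoc (α := fun _ => ℕ) x t) =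
        (-1) ^ n / poch (-(N : ℝ)) n * hahnNu d (contractParam σ n) (N - n) ν x
          * ((-1) ^ m / poch (-(N : ℝ)) m * hahnNu d (contractParam σ m) (N - m) μ x)
          * (∏ i, genBinom ((x i : ℝ) + σ i.castSucc.castSucc) (x i))
          * if n = m ∧ n ≤ N - ∑ i, x i then
              poch (σ (Fin.last d).castSucc + σ (Fin.last (d + 1)) + n + 1) n
                * poch (σ (Fin.last d).castSucc + 1) n * (n.factorial : ℝ)
                / poch (σ (Fin.last (d + 1)) + 1) n
                * (poch (σ (Fin.last d).castSucc + σ (Fin.last (d + 1)) + 2 * n + 2)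
                    (N - ∑ i, x i - n) / ((N - ∑ i, x i - n).factorial : ℝ))
            else 0 := by
      intro x hx
      rw [mem_latticeSimplex] at hx
      rw [← hahn_orthogonality, Finset.mul_sum]
      refine Finset.sum_congr rfl fun t ht => ?_
      rw [Finset.mem_range] at ht
      rw [hahnNu_snoc σ ν x n t hn hx, hahnNu_snoc σ μ x m t hm hx, Whahn_snoc σ x (by omega)]
      ring
    rw [sum_latticeSimplex_succ, Finset.sum_congr rfl hinner]
    by_cases hnm : n = m
    · subst hnm
      have hsub : latticeSimplex d (N - n) ⊆ latticeSimplex d N := fun x hx => by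
        rw [mem_latticeSimplex] at hx ⊢
        omega
      have hih := ih (N - n) (contractParam σ n) ν μ (by omega) (by omega)
      rw [← Finset.sum_subset hsub]
      · trans ((-1) ^ n / poch (-(N : ℝ)) n) ^ 2
            * (poch (σ (Fin.last d).castSucc + σ (Fin.last (d + 1)) + n + 1) n
              * poch (σ (Fin.last d).castSucc + 1) n * (n.factorial : ℝ)
              / poch (σ (Fin.last (d + 1)) + 1) n)
            * ∑ x ∈ latticeSimplex d (N - n), hahnNu d (contractParam σ n) (N - n) ν x
              * hahnNu d (contractParam σ n) (N - n) μ x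
              * Whahn d (contractParam σ n) (N - n) x
        · rw [Finset.mul_sum]
          refine Finset.sum_congr rfl fun x hx => ?_
          rw [mem_latticeSimplex] at hx
          rw [if_pos ⟨rfl, by omega⟩, Whahn_eq _ _ hx, contractParam_last, Nat.sub_right_comm N n]
          simp only [contractParam_castSucc]
          rw [show σ (Fin.last d).castSucc + σ (Fin.last (d + 1)) + 1 + 2 * n + 1 =
            σ (Fin.last d).castSucc + σ (Fin.last (d + 1)) + 2 * n + 2 by ring]
          ring
        rw [hih]
        by_cases h : ν = μ
        · subst h
          rw [if_pos rfl, if_pos rfl, AnuHahn_snoc σ ν n hn]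
        · rw [if_neg h, if_neg, mul_zero]
          intro h'
          exact h (Fin.snoc_injective2 h').1
      · intro x hx hx'
        rw [mem_latticeSimplex] at hx hx'
        rw [if_neg (by omega), mul_zero]
    · rw [if_neg]
      · exact Finset.sum_eq_zero fun x _ => by rw [if_neg (fun h => hnm h.1), mul_zero]
      · intro h
        exact hnm (Fin.snoc_injective2 h).2

end SeveralVariables

/-- Theorem 5.5: orthogonality of the Hahn polynomials of several variables on
the truncated simplex `V^d_{N,S} = {x ∈ ℕ₀^d : |x| ≤ N, x_i ≤ l_i for i ∈ S}`,
with the same norm `A_ν` as in (5.32). -/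
theorem hahnNu_orthogonality_truncated (d : ℕ) (hd : 1 ≤ d) (N : ℕ) (hN : 0 < N)
    (S : Finset (Fin d)) (hS : S.Nonempty) (l : Fin d → ℕ)
    (hl : ∀ i ∈ S, 1 ≤ l i ∧ l i ≤ N)
    (hfull : S = Finset.univ → N < ∑ i, l i)
    (σ : Fin (d + 1) → ℝ)
    (hσS : ∀ i ∈ S, σ i.castSucc = -(l i : ℝ) - 1)
    (hσc : ∀ i : Fin d, i ∉ S → -1 < σ i.castSucc)
    (hσlast : -1 < σ (Fin.last d))
    (ν μ : Fin d → ℕ)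
    (hν : ∑ i, ν i ≤ N ∧ ∀ i ∈ S, ν i ≤ l i)
    (hμ : ∑ i, μ i ≤ N ∧ ∀ i ∈ S, μ i ≤ l i) :
    ∑ x ∈ Finset.filter (fun x => ∑ i, x i ≤ N ∧ ∀ i ∈ S, x i ≤ l i)
        (Finset.Iic fun _ : Fin d => N),
        hahnNu d σ N ν x * hahnNu d σ N μ x * Whahn d σ N x
      = if ν = μ then AnuHahn d σ N ν else 0 := by
  rw [← hahnNu_orthogonality_simplex d N σ ν μ hν.1 hμ.1]
  refine Finset.sum_subset (fun x hx => ?_) (fun x hx hx' => ?_)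
  · exact mem_latticeSimplex.mpr (Finset.mem_filter.mp hx).2.1
  · have hsum := mem_latticeSimplex.mp hx
    rw [Finset.mem_filter, not_and, not_and] at hx'
    have hex := hx' (Finset.mem_filter.mp hx).1 hsum
    push Not at hex
    obtain ⟨i, hi, hlt⟩ := hex
    have hzero : genBinom ((x i : ℝ) + σ i.castSucc) (x i) = 0 := by
      rw [genBinom_add_self, hσS i hi, sub_add_cancel, poch_neg_natCast_of_lt hlt, zero_div]
    rw [Whahn, Finset.prod_eq_zero (Finset.mem_univ i) hzero, zero_mul, mul_zero]
end

section
/- Let d ≥ 1, N ∈ ℕ, and p = (p_1,…,p_d) with p_i > 0 for all i and |p| = p_1+⋯+p_d < 1; set p_{d+1} = 1 − |p|. For ν ∈ ℕ_0^d with |ν| ≤ N define K_ν(x; p, N) = [(−1)^{|ν|}/(−N)_{|ν|}] · Π_{j=1}^d [p_j^{ν_j}/(1−p_1−⋯−p_j)^{ν_j}] · (−N+|X_{j−1}|+|ν^{j+1}|)_{ν_j} K_{ν_j}(x_j; p_j/(1−p_1−⋯−p_{j−1}), N−|X_{j−1}|−|ν^{j+1}|). Then for all ν, μ ∈ ℕ_0^d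 with |ν| ≤ N and |μ| ≤ N, Σ_{x ∈ ℕ_0^d, |x| ≤ N} K_ν(x;p,N) K_μ(x;p,N) Π_{i=1}^{d+1} p_i^{x_i}/x_i! = δ_{ν,μ} · [(−1)^{|ν|}/((−N)_{|ν|} N!)] · Π_{j=1}^d [ν_j! p_j^{ν_j} / (1−p_1−⋯−p_j)^{ν_j−ν_{j+1}}], where x_{d+1} = N − |x| and ν_{d+1} = 0. -/
open Finset

/-- `(−M)_n K_n(x; q, M)` where `K_n` is the Krawtchouk polynomial, interpreted
via the cancellation `(−M)_n/(−M)_k = (−M+k)_{n−k}`: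
`Σ_{k=0}^n (−n)_k (−x)_k (−M+k)_{n−k} / (k! q^k)`. -/
noncomputable def krawM (n : ℕ) (x q M : ℝ) : ℝ :=
  ∑ k ∈ Finset.range (n + 1),
    poch (-(n : ℝ)) k * poch (-x) k * poch (-M + (k : ℝ)) (n - k)
      / ((Nat.factorial k : ℝ) * q ^ k)

/-- The Krawtchouk polynomials `K_ν(x; p, N)` of several variables, (6.8). -/
noncomputable def krawNu (d : ℕ) (p : Fin d → ℝ) (N : ℕ) (ν x : Fin d → ℕ) : ℝ :=
  (-1 : ℝ) ^ (∑ i, ν i) / poch (-(N : ℝ)) (∑ i, ν i)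
    * ∏ j, (p j ^ (ν j) / (1 - headTo d p j - p j) ^ (ν j))
      * krawM (ν j) (x j : ℝ) (p j / (1 - headTo d p j))
          ((N : ℝ) - headTo d (fun i => (x i : ℝ)) j
            - tailFrom d (fun i => (ν i : ℝ)) (j.val + 1))

/-- `ν_{j+1}`, the successor entry of `ν` (with `ν_{d+1} = 0`), as an integer. -/
def nuNext (d : ℕ) (ν : Fin d → ℕ) (j : Fin d) : ℤ :=
  if h : j.val + 1 < d then (ν ⟨j.val + 1, h⟩ : ℤ) else 0

lemma poch_neg_natCast (a k : ℕ) : poch (-(a : ℝ)) k = (-1) ^ k * (a.descFactorial k : ℝ) := by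
  induction k with
  | zero => simp [poch]
  | succ k ih =>
    unfold poch at ih ⊢
    rw [Finset.prod_range_succ, ih, Nat.descFactorial_succ]
    rcases le_or_gt k a with h | h
    · push_cast [Nat.cast_sub h]
      ring
    · simp [Nat.descFactorial_eq_zero_iff_lt.mpr h]

/-- Generating polynomial `(1 - r X)^x (1 + X)^(M - x)` of the Krawtchouk polynomials. -/
noncomputable def krawGen (r : ℝ) (M x : ℕ) : Polynomial ℝ :=
  (1 - Polynomial.C r * Polynomial.X) ^ x * (1 + Polynomial.X) ^ (M - x)

lemma krawGen_coeff {q : ℝ} (hq : q ≠ 0) {M x : ℕ} (hx : x ≤ M) (n : ℕ) :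
    (krawGen ((1 - q) / q) M x).coeff n
      = ∑ k ∈ range (n + 1), (-1 / q) ^ k * (x.choose k : ℝ) * ((M - k).choose (n - k) : ℝ) := by
  have hexp : krawGen ((1 - q) / q) M x
      = ∑ k ∈ range (x + 1), Polynomial.C ((-1 / q) ^ k * (x.choose k : ℝ))
          * ((1 + Polynomial.X) ^ (M - k) * Polynomial.X ^ k) := by
    have hlin : (1 - Polynomial.C ((1 - q) / q) * Polynomial.X : Polynomial ℝ)
        = Polynomial.C (-1 / q) * Polynomial.X + (1 + Polynomial.X) := by
      have : (1 - q) / q = 1 / q - 1 := by field_simp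
      rw [this, neg_div]
      simp only [map_sub, map_neg, Polynomial.C_1]
      ring
    rw [krawGen, hlin, add_pow, Finset.sum_mul]
    refine Finset.sum_congr rfl fun k hk => ?_
    have hk : k ≤ x := Nat.lt_succ_iff.mp (Finset.mem_range.mp hk)
    rw [show M - k = (x - k) + (M - x) by omega, pow_add, mul_pow]
    simp only [map_mul, map_pow, map_natCast]
    ring
  rw [hexp, Polynomial.finsetSum_coeff]
  simp only [Polynomial.coeff_C_mul, Polynomial.coeff_mul_X_pow', Polynomial.coeff_one_add_X_pow]
  have hmin : ∀ s : ℕ, min x n ≤ s →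
      ∑ k ∈ range (s + 1), (-1 / q) ^ k * (x.choose k : ℝ)
        * (if k ≤ n then ((M - k).choose (n - k) : ℝ) else 0)
      = ∑ k ∈ range (min x n + 1), (-1 / q) ^ k * (x.choose k : ℝ)
        * (if k ≤ n then ((M - k).choose (n - k) : ℝ) else 0) := by
    intro s hs
    refine (Finset.sum_subset (Finset.range_mono (by omega)) fun k _ hk => ?_).symm
    rw [Finset.mem_range] at hk
    by_cases hkn : k ≤ n
    · rw [Nat.choose_eq_zero_of_lt (show x < k by omega)]
      simp
    · simp [hkn]
  rw [hmin x (min_le_left _ _), ← hmin n (min_le_right _ _)]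
  refine Finset.sum_congr rfl fun k hk => ?_
  rw [if_pos (Nat.lt_succ_iff.mp (Finset.mem_range.mp hk))]

lemma krawM_eq_coeff_krawGen {q : ℝ} (hq : q ≠ 0) {M x : ℕ} (hx : x ≤ M) (n : ℕ) :
    krawM n x q M = (-1) ^ n * (n.factorial : ℝ) * (krawGen ((1 - q) / q) M x).coeff n := by
  rw [krawGen_coeff hq hx, Finset.mul_sum, krawM]
  refine Finset.sum_congr rfl fun k hk => ?_
  have hk : k ≤ n := Nat.lt_succ_iff.mp (Finset.mem_range.mp hk)
  rw [poch_neg_natCast, poch_neg_natCast]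
  rcases le_or_gt k x with hkx | hkx
  · have hM : -(M : ℝ) + k = -((M - k : ℕ) : ℝ) := by
      push_cast [Nat.cast_sub (hkx.trans hx)]
      ring
    rw [hM, poch_neg_natCast, Nat.descFactorial_eq_factorial_mul_choose x,
      Nat.descFactorial_eq_factorial_mul_choose (M - k), ← Nat.factorial_mul_descFactorial hk]
    have hsign : ((-1 : ℝ)) ^ n = (-1) ^ k * (-1) ^ (n - k) := by
      rw [← pow_add]
      congr 1
      omega
    have hfac : (k.factorial : ℝ) ≠ 0 := by exact_mod_cast k.factorial_ne_zero
    rw [hsign, div_pow]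
    push_cast
    field_simp
  · rw [Nat.descFactorial_eq_zero_iff_lt.mpr hkx, Nat.choose_eq_zero_of_lt hkx]
    simp

/-- Bilinear generating function of the Krawtchouk polynomials. -/
lemma sum_krawGen_eval {a b : ℝ} (ha : a ≠ 0) (M : ℕ) (s t : ℝ) :
    ∑ x ∈ range (M + 1), a ^ x / (x.factorial : ℝ) * (b ^ (M - x) / ((M - x).factorial : ℝ))
        * (krawGen (b / a) M x).eval s * (krawGen (b / a) M x).eval t
      = (a + b) ^ M / (M.factorial : ℝ) * (1 + b / a * s * t) ^ M := by
  have hbase : (a + b) * (1 + b / a * s * t)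
      = a * (1 - b / a * s) * (1 - b / a * t) + b * (1 + s) * (1 + t) := by
    field_simp
    ring
  rw [div_mul_eq_mul_div, ← mul_pow, hbase, add_pow, Finset.sum_div]
  refine Finset.sum_congr rfl fun x hx => ?_
  have hx : x ≤ M := Nat.lt_succ_iff.mp (Finset.mem_range.mp hx)
  have hM : (M.factorial : ℝ) = (M.choose x : ℝ) * x.factorial * (M - x).factorial := by
    exact_mod_cast (Nat.choose_mul_factorial_mul_factorial hx).symm
  have h1 : (x.factorial : ℝ) ≠ 0 := by exact_mod_cast x.factorial_ne_zero
  have h2 : ((M - x).factorial : ℝ) ≠ 0 := by exact_mod_cast (M - x).factorial_ne_zero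
  have h3 : (M.choose x : ℝ) ≠ 0 := by exact_mod_cast (Nat.choose_pos hx).ne'
  simp only [krawGen, Polynomial.eval_mul, Polynomial.eval_pow, Polynomial.eval_sub,
    Polynomial.eval_add, Polynomial.eval_one, Polynomial.eval_C, Polynomial.eval_X, mul_pow, hM]
  field_simp

lemma sum_krawGen_coeff {a b : ℝ} (ha : a ≠ 0) (M n m : ℕ) :
    ∑ x ∈ range (M + 1), a ^ x / (x.factorial : ℝ) * (b ^ (M - x) / ((M - x).factorial : ℝ))
        * (krawGen (b / a) M x).coeff n * (krawGen (b / a) M x).coeff m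
      = if n = m then (a + b) ^ M / (M.factorial : ℝ) * (M.choose n : ℝ) * (b / a) ^ n else 0 := by
  have hcoeff (t : ℝ) :
      ∑ x ∈ range (M + 1), a ^ x / (x.factorial : ℝ) * (b ^ (M - x) / ((M - x).factorial : ℝ))
          * (krawGen (b / a) M x).eval t * (krawGen (b / a) M x).coeff n
        = (a + b) ^ M / (M.factorial : ℝ) * ((b / a * t) ^ n * (M.choose n : ℝ)) := by
    have hpoly : ∑ x ∈ range (M + 1), Polynomial.C (a ^ x / (x.factorial : ℝ)
          * (b ^ (M - x) / ((M - x).factorial : ℝ)) * (krawGen (b / a) M x).eval t)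
          * krawGen (b / a) M x
        = Polynomial.C ((a + b) ^ M / (M.factorial : ℝ))
          * ((1 + Polynomial.X) ^ M).comp (Polynomial.C (b / a * t) * Polynomial.X) := by
      refine Polynomial.funext fun s => ?_
      have := sum_krawGen_eval (b := b) ha M t s
      simpa [Polynomial.eval_finsetSum] using this
    have := congrArg (fun f => Polynomial.coeff f n) hpoly
    simp only [Polynomial.finsetSum_coeff, Polynomial.coeff_C_mul,
      Polynomial.comp_C_mul_X_coeff, Polynomial.coeff_one_add_X_pow] at this
    rw [this]
    ring
  have hpoly : ∑ x ∈ range (M + 1), Polynomial.C (a ^ x / (x.factorial : ℝ)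
        * (b ^ (M - x) / ((M - x).factorial : ℝ)) * (krawGen (b / a) M x).coeff n)
        * krawGen (b / a) M x
      = Polynomial.C ((a + b) ^ M / (M.factorial : ℝ) * (M.choose n : ℝ) * (b / a) ^ n)
        * Polynomial.X ^ n := by
    refine Polynomial.funext fun t => ?_
    simp only [Polynomial.eval_finsetSum, Polynomial.eval_mul, Polynomial.eval_C,
      Polynomial.eval_pow, Polynomial.eval_X]
    rw [show (a + b) ^ M / (M.factorial : ℝ) * (M.choose n : ℝ) * (b / a) ^ n * t ^ n
      = (a + b) ^ M / (M.factorial : ℝ) * ((b / a * t) ^ n * (M.choose n : ℝ)) by ring, ← hcoeff t]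
    exact Finset.sum_congr rfl fun x _ => by ring
  have := congrArg (fun f => Polynomial.coeff f m) hpoly
  simp only [Polynomial.finsetSum_coeff, Polynomial.coeff_C_mul, Polynomial.coeff_X_pow] at this
  rw [this]
  simp [eq_comm]

/-- Orthogonality of the Krawtchouk polynomials of one variable. -/
lemma krawM_orthogonality {a b : ℝ} (ha : 0 < a) (hb : 0 < b) (M n m : ℕ) :
    ∑ x ∈ range (M + 1), krawM n x (a / (a + b)) M * krawM m x (a / (a + b)) M
        * (a ^ x / (x.factorial : ℝ) * (b ^ (M - x) / ((M - x).factorial : ℝ)))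
      = if n = m ∧ n ≤ M then
          (a + b) ^ M / ((M - n).factorial : ℝ) * n.factorial * (b / a) ^ n
        else 0 := by
  have hab : a + b ≠ 0 := by positivity
  have hq : a / (a + b) ≠ 0 := by positivity
  have hr : (1 - a / (a + b)) / (a / (a + b)) = b / a := by
    field_simp
    ring
  have hsum := sum_krawGen_coeff (b := b) ha.ne' M n m
  trans ((-1) ^ n * (n.factorial : ℝ)) * ((-1) ^ m * (m.factorial : ℝ))
    * ∑ x ∈ range (M + 1), a ^ x / (x.factorial : ℝ) * (b ^ (M - x) / ((M - x).factorial : ℝ))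
        * (krawGen (b / a) M x).coeff n * (krawGen (b / a) M x).coeff m
  · rw [Finset.mul_sum]
    refine Finset.sum_congr rfl fun x hx => ?_
    have hx : x ≤ M := Nat.lt_succ_iff.mp (Finset.mem_range.mp hx)
    rw [krawM_eq_coeff_krawGen hq hx, krawM_eq_coeff_krawGen hq hx, hr]
    ring
  rw [hsum]
  by_cases hnm : n = m
  · subst hnm
    have hsign : ((-1 : ℝ) ^ n) * (-1) ^ n = 1 := by rw [← mul_pow]; simp
    rcases le_or_gt n M with hn | hn
    · have hM : (M.factorial : ℝ) = (M.choose n : ℝ) * n.factorial * (M - n).factorial := by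
        exact_mod_cast (Nat.choose_mul_factorial_mul_factorial hn).symm
      have h1 : (n.factorial : ℝ) ≠ 0 := by exact_mod_cast n.factorial_ne_zero
      have h2 : ((M - n).factorial : ℝ) ≠ 0 := by exact_mod_cast (M - n).factorial_ne_zero
      have h3 : (M.choose n : ℝ) ≠ 0 := by exact_mod_cast (Nat.choose_pos hn).ne'
      rw [if_pos rfl, if_pos ⟨rfl, hn⟩, hM, mul_mul_mul_comm ((-1) ^ n), hsign]
      field_simp
    · simp [Nat.choose_eq_zero_of_lt hn, hn.not_ge]
  · simp [hnm]

/-- The points of `ℕ₀^d` with coordinate sum at most `N`. -/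
def simplexPoints (d N : ℕ) : Finset (Fin d → ℕ) :=
  Finset.filter (fun x => ∑ i, x i ≤ N) (Finset.Iic fun _ : Fin d => N)

lemma mem_simplexPoints {d N : ℕ} {x : Fin d → ℕ} : x ∈ simplexPoints d N ↔ ∑ i, x i ≤ N := by
  simp only [simplexPoints, Finset.mem_filter, Finset.mem_Iic, and_iff_right_iff_imp]
  intro h i
  exact (Finset.single_le_sum (fun i _ => Nat.zero_le (x i)) (Finset.mem_univ i)).trans h

lemma sum_simplexPoints_succ (d N : ℕ) (f : (Fin (d + 1) → ℕ) → ℝ) :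
    ∑ x ∈ simplexPoints (d + 1) N, f x
      = ∑ x ∈ simplexPoints d N, ∑ k ∈ range (N - ∑ i, x i + 1), f (Fin.snoc x k) := by
  rw [Finset.sum_sigma']
  refine Finset.sum_bij' (fun x _ => ⟨fun i => x i.castSucc, x (Fin.last d)⟩)
    (fun y _ => Fin.snoc y.1 y.2) ?_ ?_ ?_ ?_ ?_
  · intro x hx
    rw [mem_simplexPoints, Fin.sum_univ_castSucc] at hx
    simp only [Finset.mem_sigma, mem_simplexPoints, Finset.mem_range]
    omega
  · rintro ⟨y, k⟩ hy
    simp only [Finset.mem_sigma, mem_simplexPoints, Finset.mem_range] at hy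
    simp only [mem_simplexPoints, Fin.sum_univ_castSucc, Fin.snoc_castSucc, Fin.snoc_last]
    omega
  · intro x _
    exact Fin.snoc_init_self x
  · rintro ⟨y, k⟩ _
    simp
  · intro x _
    exact congrArg f (Fin.snoc_init_self x).symm

lemma headTo_castSucc (d : ℕ) (y : Fin (d + 1) → ℝ) (j : Fin d) :
    headTo (d + 1) y j.castSucc = headTo d (fun i => y i.castSucc) j := by
  simp only [headTo, Fin.sum_univ_castSucc, Fin.val_castSucc, Fin.val_last]
  rw [if_neg (by have := j.isLt; omega), add_zero]

lemma headTo_last (d : ℕ) (y : Fin (d + 1) → ℝ) :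
    headTo (d + 1) y (Fin.last d) = ∑ i : Fin d, y i.castSucc := by
  simp only [headTo, Fin.sum_univ_castSucc, Fin.val_castSucc, Fin.val_last]
  simp

lemma headTo_zero (d : ℕ) (y : Fin (d + 1) → ℝ) : headTo (d + 1) y 0 = 0 := by
  simp [headTo]

lemma headTo_succ (d : ℕ) (y : Fin (d + 1) → ℝ) (j : Fin d) :
    headTo (d + 1) y j.succ = headTo (d + 1) y j.castSucc + y j.castSucc := by
  have hsingle : y j.castSucc = ∑ i, if i = j.castSucc then y i else 0 := by simp
  rw [hsingle]
  simp only [headTo]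
  rw [← Finset.sum_add_distrib]
  refine Finset.sum_congr rfl fun i _ => ?_
  simp only [Fin.val_succ, Fin.val_castSucc, Fin.ext_iff]
  rcases lt_trichotomy i.val j.val with h | h | h
  · rw [if_pos (by omega), if_pos h, if_neg h.ne, add_zero]
  · rw [if_pos (by omega), if_neg (by omega), if_pos h, zero_add]
  · rw [if_neg (by omega), if_neg (by omega), if_neg h.ne', add_zero]

lemma tailFrom_castSucc (d : ℕ) (y : Fin (d + 1) → ℝ) {t : ℕ} (ht : t ≤ d) :
    tailFrom (d + 1) y t = tailFrom d (fun i => y i.castSucc) t + y (Fin.last d) := by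
  simp only [tailFrom, Fin.sum_univ_castSucc, Fin.val_castSucc, Fin.val_last, if_pos ht]

lemma tailFrom_self (d : ℕ) (y : Fin d → ℝ) : tailFrom d y d = 0 := by
  simp only [tailFrom]
  exact Finset.sum_eq_zero fun i _ => if_neg (by have := i.isLt; omega)

lemma one_sub_headTo_sub_pos {d : ℕ} {p : Fin d → ℝ} (hp : ∀ i, 0 < p i) (hpsum : ∑ i, p i < 1)
    (j : Fin d) : 0 < 1 - headTo d p j - p j := by
  have hle : headTo d p j + p j ≤ ∑ i, p i := by
    have hsingle : p j = ∑ i, if i = j then p i else 0 := by simp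
    rw [hsingle, headTo, ← Finset.sum_add_distrib]
    refine Finset.sum_le_sum fun i _ => ?_
    have := hp i
    rcases eq_or_ne i j with h | h
    · simp [h]
    · split_ifs <;> linarith
  linarith

/-- The product of the one-variable factors of `krawNu`, without its normalization. -/
noncomputable def krawProd (d : ℕ) (p : Fin d → ℝ) (N : ℝ) (ν x : Fin d → ℕ) : ℝ :=
  ∏ j, krawM (ν j) (x j : ℝ) (p j / (1 - headTo d p j))
    (N - headTo d (fun i => (x i : ℝ)) j - tailFrom d (fun i => (ν i : ℝ)) (j.val + 1))

lemma krawProd_snoc (d : ℕ) (p : Fin (d + 1) → ℝ) (N : ℝ) (ν : Fin (d + 1) → ℕ)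
    (x : Fin d → ℕ) (k : ℕ) :
    krawProd (d + 1) p N ν (Fin.snoc x k)
      = krawProd d (fun i => p i.castSucc) (N - ν (Fin.last d)) (fun i => ν i.castSucc) x
        * krawM (ν (Fin.last d)) k (p (Fin.last d) / (1 - ∑ i : Fin d, p i.castSucc))
          (N - ∑ i, (x i : ℝ)) := by
  simp only [krawProd, Fin.prod_univ_castSucc, headTo_castSucc, headTo_last, Fin.snoc_castSucc,
    Fin.snoc_last, Fin.val_castSucc, Fin.val_last, tailFrom_self, sub_zero]
  congr 1
  refine Finset.prod_congr rfl fun j _ => ?_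
  rw [tailFrom_castSucc d _ j.isLt]
  congr 1
  ring

lemma krawProd_orthogonality (d : ℕ) (N : ℕ) (p : Fin d → ℝ) (hp : ∀ i, 0 < p i)
    (hpsum : ∑ i, p i < 1) (ν μ : Fin d → ℕ) (hν : ∑ i, ν i ≤ N) (hμ : ∑ i, μ i ≤ N) :
    ∑ x ∈ simplexPoints d N,
        krawProd d p N ν x * krawProd d p N μ x
          * ((∏ i, p i ^ (x i) / (Nat.factorial (x i) : ℝ))
              * ((1 - ∑ i, p i) ^ (N - ∑ i, x i)
                / (Nat.factorial (N - ∑ i, x i) : ℝ)))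
      = if ν = μ then
          (∏ j, (Nat.factorial (ν j) : ℝ)
              * ((1 - headTo d p j) * (1 - headTo d p j - p j) / p j) ^ (ν j))
            / (Nat.factorial (N - ∑ i, ν i) : ℝ)
        else 0 := by
  induction d generalizing N with
  | zero =>
    have : simplexPoints 0 N = {default} := by
      ext x
      simp [mem_simplexPoints, Subsingleton.elim x default]
    rw [this]
    simp [krawProd, Subsingleton.elim ν μ]
  | succ d ih =>
    rw [sum_simplexPoints_succ]
    set a := p (Fin.last d) with ha_def
    set P := ∑ i : Fin d, p i.castSucc with hP_def
    set n := ν (Fin.last d) with hn_def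
    set m := μ (Fin.last d) with hm_def
    rw [Fin.sum_univ_castSucc] at hpsum hν hμ
    have ha : 0 < a := hp _
    have hb : 0 < 1 - (P + a) := by linarith
    have hab : a + (1 - (P + a)) = 1 - P := by ring
    have hinner (x : Fin d → ℕ) (hx : ∑ i, x i ≤ N) :
        ∑ k ∈ range (N - ∑ i, x i + 1),
          krawProd (d + 1) p N ν (Fin.snoc x k) * krawProd (d + 1) p N μ (Fin.snoc x k)
          * ((∏ i, p i ^ ((Fin.snoc x k : Fin (d + 1) → ℕ) i)
                / (Nat.factorial ((Fin.snoc x k : Fin (d + 1) → ℕ) i) : ℝ))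
              * ((1 - ∑ i, p i) ^ (N - ∑ i, (Fin.snoc x k : Fin (d + 1) → ℕ) i)
                / (Nat.factorial (N - ∑ i, (Fin.snoc x k : Fin (d + 1) → ℕ) i) : ℝ)))
        = krawProd d (fun i => p i.castSucc) (N - n) (fun i => ν i.castSucc) x
          * krawProd d (fun i => p i.castSucc) (N - m) (fun i => μ i.castSucc) x
          * (∏ i, p i.castSucc ^ (x i) / (Nat.factorial (x i) : ℝ))
          * (if n = m ∧ n ≤ N - ∑ i, x i then
              (1 - P) ^ (N - ∑ i, x i) / ((N - ∑ i, x i - n).factorial : ℝ) * n.factorial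
                * ((1 - (P + a)) / a) ^ n
            else 0) := by
      have horth := krawM_orthogonality ha hb (N - ∑ i, x i) n m
      rw [hab] at horth
      rw [← horth, Finset.mul_sum]
      refine Finset.sum_congr rfl fun k _ => ?_
      rw [krawProd_snoc, krawProd_snoc]
      simp only [Fin.prod_univ_castSucc, Fin.sum_univ_castSucc, Fin.snoc_castSucc, Fin.snoc_last,
        ← Nat.sub_sub]
      push_cast [Nat.cast_sub hx]
      simp only [← ha_def, ← hP_def, ← hn_def, ← hm_def]
      ring
    rw [Finset.sum_congr rfl fun x hx => hinner x (mem_simplexPoints.mp hx)]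
    by_cases hnm : n = m
    swap
    · rw [if_neg fun h => hnm (by rw [hn_def, hm_def, h])]
      simp [hnm]
    have hrestrict : ∑ x ∈ simplexPoints d N,
          krawProd d (fun i => p i.castSucc) (N - n) (fun i => ν i.castSucc) x
          * krawProd d (fun i => p i.castSucc) (N - m) (fun i => μ i.castSucc) x
          * (∏ i, p i.castSucc ^ (x i) / (Nat.factorial (x i) : ℝ))
          * (if n = m ∧ n ≤ N - ∑ i, x i then
              (1 - P) ^ (N - ∑ i, x i) / ((N - ∑ i, x i - n).factorial : ℝ) * n.factorial
                * ((1 - (P + a)) / a) ^ n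
            else 0)
        = n.factorial * ((1 - P) * (1 - P - a) / a) ^ n * ∑ x ∈ simplexPoints d (N - n),
          krawProd d (fun i => p i.castSucc) (N - n : ℕ) (fun i => ν i.castSucc) x
          * krawProd d (fun i => p i.castSucc) (N - n : ℕ) (fun i => μ i.castSucc) x
          * ((∏ i, p i.castSucc ^ (x i) / (Nat.factorial (x i) : ℝ))
              * ((1 - ∑ i : Fin d, p i.castSucc) ^ (N - n - ∑ i, x i)
                / (Nat.factorial (N - n - ∑ i, x i) : ℝ))) := by
      have hnN : n ≤ N := by omega
      have hsub : simplexPoints d (N - n) ⊆ simplexPoints d N := fun x hx => by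
        rw [mem_simplexPoints] at hx ⊢
        omega
      rw [Finset.mul_sum, ← Finset.sum_subset hsub]
      · refine Finset.sum_congr rfl fun x hx => ?_
        rw [mem_simplexPoints] at hx
        rw [if_pos ⟨hnm, by omega⟩, ← hnm, Nat.cast_sub hnN, ← hP_def, Nat.sub_right_comm N n,
          show (1 - P) ^ (N - ∑ i, x i) = (1 - P) ^ (N - ∑ i, x i - n) * (1 - P) ^ n by
            rw [← pow_add]
            congr 1
            omega,
          ← sub_sub 1 P a, mul_div_assoc (1 - P), mul_pow]
        ring
      · intro x hx hx'
        rw [mem_simplexPoints] at hx hx'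
        rw [if_neg (by omega), mul_zero]
    rw [hrestrict, ih (N - n) (fun i => p i.castSucc) (fun i => hp _) (by linarith)
      (fun i => ν i.castSucc) (fun i => μ i.castSucc) (by omega) (by omega)]
    have heq : ((fun i : Fin d => ν i.castSucc) = fun i => μ i.castSucc) ↔ ν = μ := by
      refine ⟨fun h => funext fun i => ?_, fun h => by rw [h]⟩
      refine Fin.lastCases hnm (fun i => ?_) i
      exact congrFun h i
    simp only [heq]
    split_ifs
    · rw [Fin.prod_univ_castSucc, Fin.sum_univ_castSucc, headTo_last]
      simp only [headTo_castSucc, ← ha_def, ← hP_def, ← hn_def]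
      rw [Nat.sub_sub, add_comm n]
      ring
    · simp

lemma prod_zpow_nuNext (d : ℕ) (p : Fin d → ℝ) (ν : Fin d → ℕ) :
    ∏ j, (1 - headTo d p j - p j) ^ nuNext d ν j = ∏ j, (1 - headTo d p j) ^ ν j := by
  cases d with
  | zero => simp
  | succ d =>
    rw [Fin.prod_univ_castSucc, Fin.prod_univ_succ (fun j => (1 - headTo (d + 1) p j) ^ ν j)]
    have hlast : nuNext (d + 1) ν (Fin.last d) = 0 := by simp [nuNext]
    have hcast (j : Fin d) : nuNext (d + 1) ν j.castSucc = ν j.succ := by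
      have : j.castSucc.val + 1 < d + 1 := by simp
      rw [nuNext, dif_pos this]
      rfl
    rw [hlast, headTo_zero, zpow_zero, mul_one, sub_zero, one_pow, one_mul]
    refine Finset.prod_congr rfl fun j _ => ?_
    rw [hcast, headTo_succ, zpow_natCast, sub_sub]

lemma krawNu_eq_krawProd (d : ℕ) (p : Fin d → ℝ) (N : ℕ) (ν x : Fin d → ℕ) :
    krawNu d p N ν x = (-1 : ℝ) ^ (∑ i, ν i) / poch (-(N : ℝ)) (∑ i, ν i)
      * (∏ j, (p j / (1 - headTo d p j - p j)) ^ ν j) * krawProd d p N ν x := by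
  rw [krawNu, krawProd, Finset.prod_mul_distrib, mul_assoc]
  simp only [div_pow]

/-- Theorem 6.2: orthogonality of the Krawtchouk polynomials of several
variables on `V^d_N = {x ∈ ℕ₀^d : |x| ≤ N}` with respect to the weight
`Π_{i=1}^{d+1} p_i^{x_i}/x_i!` (with `x_{d+1} = N − |x|`, `p_{d+1} = 1 − |p|`). -/
theorem krawNu_orthogonality (d : ℕ) (hd : 1 ≤ d) (N : ℕ) (hN : 0 < N)
    (p : Fin d → ℝ) (hp : ∀ i, 0 < p i) (hpsum : ∑ i, p i < 1)
    (ν μ : Fin d → ℕ) (hν : ∑ i, ν i ≤ N) (hμ : ∑ i, μ i ≤ N) :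
    ∑ x ∈ Finset.filter (fun x => ∑ i, x i ≤ N) (Finset.Iic fun _ : Fin d => N),
        krawNu d p N ν x * krawNu d p N μ x
          * ((∏ i, p i ^ (x i) / (Nat.factorial (x i) : ℝ))
              * ((1 - ∑ i, p i) ^ (N - ∑ i, x i)
                / (Nat.factorial (N - ∑ i, x i) : ℝ)))
      = if ν = μ then
          (-1 : ℝ) ^ (∑ i, ν i)
            / (poch (-(N : ℝ)) (∑ i, ν i) * (Nat.factorial N : ℝ))
            * ∏ j, (Nat.factorial (ν j) : ℝ) * p j ^ (ν j)
                / (1 - headTo d p j - p j) ^ ((ν j : ℤ) - nuNext d ν j)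
        else 0 := by
  have hnorm := krawProd_orthogonality d N p hp hpsum ν μ hν hμ
  simp only [simplexPoints] at hnorm
  trans (-1 : ℝ) ^ (∑ i, ν i) / poch (-(N : ℝ)) (∑ i, ν i)
      * (∏ j, (p j / (1 - headTo d p j - p j)) ^ ν j)
      * ((-1 : ℝ) ^ (∑ i, μ i) / poch (-(N : ℝ)) (∑ i, μ i)
      * (∏ j, (p j / (1 - headTo d p j - p j)) ^ μ j))
      * (if ν = μ then
          (∏ j, (Nat.factorial (ν j) : ℝ)
              * ((1 - headTo d p j) * (1 - headTo d p j - p j) / p j) ^ (ν j))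
            / (Nat.factorial (N - ∑ i, ν i) : ℝ)
        else 0)
  · rw [← hnorm, Finset.mul_sum]
    refine Finset.sum_congr rfl fun x _ => ?_
    rw [krawNu_eq_krawProd, krawNu_eq_krawProd]
    ring
  by_cases hνμ : ν = μ
  swap
  · simp [hνμ]
  subst hνμ
  rw [if_pos rfl, if_pos rfl]
  have hs (j : Fin d) : 1 - headTo d p j - p j ≠ 0 := (one_sub_headTo_sub_pos hp hpsum j).ne'
  have hright : ∏ j, (Nat.factorial (ν j) : ℝ) * p j ^ (ν j)
        / (1 - headTo d p j - p j) ^ ((ν j : ℤ) - nuNext d ν j)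
      = (∏ j, (p j / (1 - headTo d p j - p j)) ^ ν j)
        * (∏ j, (p j / (1 - headTo d p j - p j)) ^ ν j)
        * ∏ j, (Nat.factorial (ν j) : ℝ)
              * ((1 - headTo d p j) * (1 - headTo d p j - p j) / p j) ^ (ν j) := by
    trans ∏ j, ((Nat.factorial (ν j) : ℝ) * p j ^ (ν j) / (1 - headTo d p j - p j) ^ (ν j)
        * (1 - headTo d p j - p j) ^ nuNext d ν j)
    · refine Finset.prod_congr rfl fun j _ => ?_
      rw [zpow_sub₀ (hs j), zpow_natCast, div_div_eq_mul_div, mul_div_right_comm]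
    rw [Finset.prod_mul_distrib, prod_zpow_nuNext, ← Finset.prod_mul_distrib,
      ← Finset.prod_mul_distrib, ← Finset.prod_mul_distrib]
    refine Finset.prod_congr rfl fun j _ => ?_
    have h1 := hs j
    have h2 := (hp j).ne'
    simp only [div_pow, mul_pow]
    field_simp
  rw [hright]
  set n := ∑ i, ν i
  have hfac : (N.factorial : ℝ) = (N - n).factorial * (N.descFactorial n : ℝ) := by
    exact_mod_cast (Nat.factorial_mul_descFactorial hν).symm
  have h1 : ((N - n).factorial : ℝ) ≠ 0 := by exact_mod_cast (N - n).factorial_ne_zero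
  have h2 : (N.descFactorial n : ℝ) ≠ 0 := by
    exact_mod_cast (Nat.descFactorial_eq_zero_iff_lt.not.mpr hν.not_gt)
  rw [poch_neg_natCast, hfac]
  field_simp
end
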